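/- A Banach space E is (1,ℵ)-injective if and only if every family of fewer than ℵ mutually intersecting closed balls in E has nonempty intersection. -/

import Mathlib

open Cardinal

/-- The density character of a topological space: the least cardinality of a dense subset. -/
noncomputable def dens (X : Type) [TopologicalSpace X] : Cardinal :=
  sInf {c | ∃ s : Set X, Dense s ∧ #s = c}

/-- A Banach space `E` is `(1,ℵ)`-injective if for every Banach space `X` with
`dens X < ℵ`, every closed subspace `Y ⊆ X` and every operator `t : Y → E`, there is an
extension `T : X → E` with `‖T‖ ≤ ‖t‖`. -/
def OneAlephInjective (E : Type) [NormedAddCommGroup E] [NormedSpace ℝ E] [CompleteSpace E]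
    (ℵ : Cardinal) : Prop :=
  ∀ (X : Type) [NormedAddCommGroup X] [NormedSpace ℝ X] [CompleteSpace X],
    dens X < ℵ → ∀ (Y : Submodule ℝ X), IsClosed (Y : Set X) →
    ∀ t : Y →L[ℝ] E, ∃ T : X →L[ℝ] E, ‖T‖ ≤ ‖t‖ ∧ ∀ y : Y, T y = t y

open Set Metric

/-- A subset of the closure of `range v` has a dense subset not larger than `max #κ ℵ₀`. -/
theorem exists_dense_mk_le {F : Type} [PseudoMetricSpace F] {κ : Type} (v : κ → F) (p : Set F)
    (h : p ⊆ closure (range v)) : ∃ D : Set p, Dense D ∧ #D ≤ max #κ ℵ₀ := by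
  classical
  let A := {a : κ × ℕ // ∃ y : p, dist (y : F) (v a.1) < 1 / ((a.2 : ℝ) + 1)}
  let g : A → p := fun a => a.2.choose
  have hg : ∀ a : A, dist (g a : F) (v a.1.1) < 1 / ((a.1.2 : ℝ) + 1) := fun a => a.2.choose_spec
  refine ⟨range g, ?_, ?_⟩
  · refine Metric.dense_iff.2 fun x ε hε => ?_
    obtain ⟨n, hn⟩ := exists_nat_one_div_lt (half_pos hε)
    obtain ⟨_, ⟨k, rfl⟩, hk⟩ := Metric.mem_closure_iff.1 (h x.2) (1 / ((n : ℝ) + 1)) (by positivity)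
    refine ⟨g ⟨(k, n), x, hk⟩, ?_, mem_range_self _⟩
    have h1 := hg ⟨(k, n), x, hk⟩
    have h2 := dist_triangle_right (g ⟨(k, n), x, hk⟩ : F) (x : F) (v k)
    rw [mem_ball, Subtype.dist_eq]
    simp only at h1
    linarith
  · calc #(range g) ≤ #A := mk_range_le
      _ ≤ #(κ × ℕ) := mk_subtype_le _
      _ ≤ max #κ ℵ₀ := by
        rw [mk_prod, lift_id, lift_id, mk_nat]
        exact (mul_le_max _ _).trans (by simp)

theorem exists_dense_mk_eq_dens (X : Type) [TopologicalSpace X] :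
    ∃ D : Set X, Dense D ∧ #D = dens X :=
  csInf_mem (s := {c | ∃ s : Set X, Dense s ∧ #s = c}) ⟨_, univ, dense_univ, rfl⟩

theorem dens_le {X : Type} [TopologicalSpace X] {D : Set X} (hD : Dense D) : dens X ≤ #D :=
  csInf_le' ⟨D, hD, rfl⟩

/-- The closed span of a family indexed by `ι` has density character at most `max #ι ℵ₀`. -/
theorem dens_topologicalClosure_span_le {F : Type} [NormedAddCommGroup F] [NormedSpace ℝ F]
    {ι : Type} (v : ι → F) :
    dens (Submodule.span ℝ (range v)).topologicalClosure ≤ max #ι ℵ₀ := by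
  let φ : (ι →₀ ℚ) →+ F := (Finsupp.linearCombination ℝ v).toAddMonoidHom.comp
    (Finsupp.mapRange.addMonoidHom (Rat.castHom ℝ).toAddMonoidHom)
  have hsmul : ∀ (q : ℚ) (f : ι →₀ ℚ), φ (q • f) = (q : ℝ) • φ f := by
    intro q f
    simp only [φ, AddMonoidHom.comp_apply, LinearMap.toAddMonoidHom_coe]
    rw [← map_smul]
    congr 1
    ext i
    simp
  let P : Submodule ℝ F :=
    { φ.range.topologicalClosure with
      smul_mem' := by
        intro c x hx
        refine map_mem_closure₂ (f := fun (a : ℝ) (y : F) => a • y) (s := range ((↑) : ℚ → ℝ))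
          (t := φ.range) (u := φ.range) continuous_smul
          (Rat.denseRange_cast c) hx ?_
        rintro _ ⟨q, rfl⟩ _ ⟨f, rfl⟩
        exact ⟨q • f, hsmul q f⟩ }
  have hP : (P : Set F) = closure (range φ) := rfl
  have hle : (Submodule.span ℝ (range v)).topologicalClosure ≤ P := by
    refine Submodule.topologicalClosure_minimal _ (Submodule.span_le.2 ?_) ?_
    · rintro _ ⟨i, rfl⟩
      rw [hP]
      exact subset_closure ⟨Finsupp.single i 1, by simp [φ]⟩
    · rw [hP]; exact isClosed_closure
  obtain ⟨D, hD, hc⟩ := exists_dense_mk_le φ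
    ((Submodule.span ℝ (range v)).topologicalClosure : Set F) fun x hx => hle hx
  refine (dens_le hD).trans (hc.trans (max_le ?_ (le_max_right _ _)))
  cases isEmpty_or_nonempty ι
  · exact mk_le_aleph0.trans (le_max_right _ _)
  · simp

/-- The canonical isometric embedding into the bounded functions on the dual unit ball. -/
noncomputable def dualBallEmbedding (E : Type) [NormedAddCommGroup E] [NormedSpace ℝ E] :
    E →ₗᵢ[ℝ] lp (fun _ : {γ : StrongDual ℝ E // ‖γ‖ ≤ 1} => ℝ) ⊤ where
  toFun x := ⟨fun γ => γ.1 x, memℓp_infty ⟨‖x‖, by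
    rintro _ ⟨γ, rfl⟩
    exact γ.1.le_of_opNorm_le_of_le γ.2 le_rfl |>.trans (one_mul _).le⟩⟩
  map_add' x y := by ext γ; exact map_add γ.1 x y
  map_smul' c x := by ext γ; exact map_smul γ.1 c x
  norm_map' x := by
    apply le_antisymm
    · refine lp.norm_le_of_forall_le (norm_nonneg x) fun γ => ?_
      exact γ.1.le_of_opNorm_le_of_le γ.2 le_rfl |>.trans (one_mul _).le
    · obtain ⟨g, hg, hgx⟩ := exists_dual_vector'' ℝ x
      refine le_trans ?_ (lp.norm_apply_le_norm ENNReal.top_ne_zero _ ⟨g, hg⟩)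
      simp [hgx]

/-- Mutually intersecting balls of `ℓ^∞` have a common point. -/
theorem lp_infty_exists_norm_sub_le {Γ ι : Type} [Nonempty ι] (x : ι → lp (fun _ : Γ => ℝ) ⊤)
    (r : ι → ℝ) (h : ∀ i j, ‖x i - x j‖ ≤ r i + r j) : ∃ z, ∀ i, ‖x i - z‖ ≤ r i := by
  have key : ∀ i j γ, x j γ - r j ≤ x i γ + r i := by
    intro i j γ
    have h1 := lp.norm_apply_le_norm ENNReal.top_ne_zero (x j - x i) γ
    have h2 := (abs_le.1 (h1.trans (h j i))).2
    simp only [lp.coeFn_sub, Pi.sub_apply] at h2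
    linarith
  let f : Γ → ℝ := fun γ => ⨅ i, (x i γ + r i)
  have hf1 : ∀ i γ, f γ ≤ x i γ + r i := fun i γ =>
    ciInf_le ⟨x i γ - r i, by rintro _ ⟨j, rfl⟩; exact key j i γ⟩ i
  have hf2 : ∀ i γ, x i γ - r i ≤ f γ := fun i γ => le_ciInf fun j => key j i γ
  have hr : ∀ i, 0 ≤ r i := fun i => by
    have := h i i
    simp only [sub_self, norm_zero] at this
    linarith
  have hf : Memℓp f ⊤ := by
    obtain ⟨i⟩ := ‹Nonempty ι›
    refine memℓp_infty ⟨‖x i‖ + r i, ?_⟩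
    rintro _ ⟨γ, rfl⟩
    have h1 := abs_le.1 (lp.norm_apply_le_norm ENNReal.top_ne_zero (x i) γ)
    exact abs_le.2 ⟨by linarith [hf2 i γ], by linarith [hf1 i γ]⟩
  refine ⟨⟨f, hf⟩, fun i => lp.norm_le_of_forall_le (hr i) fun γ => ?_⟩
  exact abs_le.2 ⟨by change -r i ≤ x i γ - f γ; linarith [hf1 i γ],
    by change x i γ - f γ ≤ r i; linarith [hf2 i γ]⟩

/-- If balls of `E` have a common point in some normed space containing `E`, they have one
in `E`. -/
theorem OneAlephInjective.nonempty_iInter_closedBall_of_embedding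
    {E F : Type} [NormedAddCommGroup E] [NormedSpace ℝ E] [CompleteSpace E]
    [NormedAddCommGroup F] [NormedSpace ℝ F] [CompleteSpace F]
    {ℵ : Cardinal} (hℵ : ℵ₀ < ℵ) (hE : OneAlephInjective E ℵ) {ι : Type} (hι : #ι < ℵ)
    (x : ι → E) (r : ι → ℝ) (j : E →ₗᵢ[ℝ] F) (z : F) (hz : ∀ i, ‖j (x i) - z‖ ≤ r i) :
    (⋂ i, closedBall (x i) (r i)).Nonempty := by
  let v : Option ι → F := fun o => o.elim z fun i => j (x i)
  let X := (Submodule.span ℝ (range v)).topologicalClosure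
  have hv : ∀ o, v o ∈ X := fun o =>
    Submodule.le_topologicalClosure _ (Submodule.subset_span (mem_range_self o))
  have hXc : IsClosed (X : Set F) := Submodule.isClosed_topologicalClosure _
  have : CompleteSpace X := hXc.completeSpace_coe
  have hX : dens X < ℵ := by
    refine (dens_topologicalClosure_span_le v).trans_lt (max_lt ?_ hℵ)
    rw [mk_option]
    exact add_lt_of_lt hℵ.le hι (one_lt_aleph0.trans hℵ)
  let Y : Submodule ℝ X := (LinearMap.range j.toLinearMap).comap X.subtype
  have hY : IsClosed (Y : Set X) :=
    j.isometry.isClosedEmbedding.isClosed_range.preimage continuous_subtype_val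
  let t : Y →L[ℝ] E :=
    LinearMap.mkContinuous
      (j.equivRange.symm.toLinearEquiv.toLinearMap.comp
        ((X.subtype.comp Y.subtype).codRestrict _ fun y => y.2)) 1 fun y => by
          rw [one_mul]
          exact (j.equivRange.symm.norm_map _).le
  have ht : ‖t‖ ≤ 1 := LinearMap.mkContinuous_norm_le _ zero_le_one _
  have htj : ∀ i (hi : j (x i) ∈ X) (hi' : (⟨j (x i), hi⟩ : X) ∈ Y), t ⟨⟨j (x i), hi⟩, hi'⟩ = x i :=
    fun i hi hi' => j.equivRange.symm_apply_apply (x i)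
  obtain ⟨T, hT, hTt⟩ := hE X hX Y hY t
  refine ⟨T ⟨z, hv none⟩, mem_iInter.2 fun i => ?_⟩
  have hi : j (x i) ∈ X := hv (some i)
  have hi' : (⟨j (x i), hi⟩ : X) ∈ Y := ⟨x i, rfl⟩
  rw [mem_closedBall', dist_eq_norm, ← htj i hi hi', ← hTt, ← map_sub]
  refine (T.le_of_opNorm_le (hT.trans ht) _).trans ?_
  rw [one_mul]
  exact hz i

theorem OneAlephInjective.nonempty_iInter_closedBall
    {E : Type} [NormedAddCommGroup E] [NormedSpace ℝ E] [CompleteSpace E]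
    {ℵ : Cardinal} (hℵ : ℵ₀ < ℵ) (hE : OneAlephInjective E ℵ) {ι : Type} (hι : #ι < ℵ)
    (x : ι → E) (r : ι → ℝ) (h : ∀ i j, ‖x i - x j‖ ≤ r i + r j) :
    (⋂ i, closedBall (x i) (r i)).Nonempty := by
  cases isEmpty_or_nonempty ι
  · simp
  obtain ⟨z, hz⟩ := lp_infty_exists_norm_sub_le (fun i => dualBallEmbedding E (x i)) r fun i k => by
    rw [← map_sub, (dualBallEmbedding E).norm_map]
    exact h i k
  exact hE.nonempty_iInter_closedBall_of_embedding hℵ hι x r (dualBallEmbedding E) z hz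

/-- Passing from a domain to the span of one more vector preserves the norm bound. -/
theorem LinearPMap.norm_supSpanSingleton_le {X E : Type} [NormedAddCommGroup X] [NormedSpace ℝ X]
    [NormedAddCommGroup E] [NormedSpace ℝ E] {C : ℝ} (f : X →ₗ.[ℝ] E)
    (hf : ∀ y : f.domain, ‖f y‖ ≤ C * ‖(y : X)‖) {x : X} (hx : x ∉ f.domain) {e : E}
    (he : ∀ y : f.domain, ‖f y - e‖ ≤ C * ‖(y : X) - x‖)
    (y : (f.supSpanSingleton x e hx).domain) :
    ‖f.supSpanSingleton x e hx y‖ ≤ C * ‖(y : X)‖ := by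
  obtain ⟨y, hy⟩ := y
  obtain ⟨w, hw, _, hc, rfl⟩ := Submodule.mem_sup.1 hy
  obtain ⟨c, rfl⟩ := Submodule.mem_span_singleton.1 hc
  rw [LinearPMap.supSpanSingleton_apply_mk f x e hx w hw c]
  rcases eq_or_ne c 0 with rfl | hc0
  · simpa using hf ⟨w, hw⟩
  have h1 := he ((-c⁻¹) • ⟨w, hw⟩)
  rw [f.map_smul] at h1
  have h2 : f ⟨w, hw⟩ + c • e = (-c) • ((-c⁻¹) • f ⟨w, hw⟩ - e) := by
    rw [smul_sub, smul_smul]; simp [hc0]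
  have h3 : w + c • x = (-c) • ((-c⁻¹) • w - x) := by
    rw [smul_sub, smul_smul]; simp [hc0]
  simp only [RingHom.id_apply]
  rw [h2, h3, norm_smul, norm_smul, mul_left_comm]
  exact mul_le_mul_of_nonneg_left h1 (norm_nonneg _)

theorem oneAlephInjective_of_nonempty_iInter_closedBall
    {E : Type} [NormedAddCommGroup E] [NormedSpace ℝ E] [CompleteSpace E]
    {ℵ : Cardinal} (hℵ : ℵ₀ < ℵ)
    (H : ∀ (ι : Type), #ι < ℵ → ∀ (x : ι → E) (r : ι → ℝ), (∀ i, 0 ≤ r i) →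
      (∀ i j, ‖x i - x j‖ ≤ r i + r j) → (⋂ i, closedBall (x i) (r i)).Nonempty) :
    OneAlephInjective E ℵ := by
  intro X _ _ _ hX Y _ t
  have hsub : ∀ p : Set X, ∃ D : Set p, Dense D ∧ #D < ℵ := by
    intro p
    obtain ⟨S, hS, hSc⟩ := exists_dense_mk_eq_dens X
    obtain ⟨D, hD, hDc⟩ := exists_dense_mk_le ((↑) : S → X) p (by simp [hS.closure_eq])
    exact ⟨D, hD, hDc.trans_lt (max_lt (hSc ▸ hX) hℵ)⟩
  let f₀ : X →ₗ.[ℝ] E := ⟨Y, t⟩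
  let 𝒮 : Set (X →ₗ.[ℝ] E) := {f | ∀ y : f.domain, ‖f y‖ ≤ ‖t‖ * ‖(y : X)‖}
  have hf₀ : f₀ ∈ 𝒮 := fun y => t.le_opNorm y
  obtain ⟨f, hle, hmax⟩ := zorn_le_nonempty₀ 𝒮 (by
    intro c hc hchain y hy
    have hdir : DirectedOn (· ≤ ·) c := hchain.directedOn
    refine ⟨LinearPMap.sSup c hdir, ?_, fun g hg => LinearPMap.le_sSup hdir hg⟩
    rintro ⟨w, hw⟩
    obtain ⟨g, hg, hwg⟩ := (LinearPMap.mem_domain_sSup_iff ⟨y, hy⟩ hdir).1 hw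
    rw [LinearPMap.sSup_apply hdir hg ⟨w, hwg⟩]
    exact hc hg ⟨w, hwg⟩) f₀ hf₀
  have hf : ∀ y : f.domain, ‖f y‖ ≤ ‖t‖ * ‖(y : X)‖ := hmax.1
  have htop : f.domain = ⊤ := by
    refine (Submodule.eq_top_iff'.2 fun x => ?_)
    by_contra hx
    obtain ⟨D, hD, hDc⟩ := hsub f.domain
    obtain ⟨e, he⟩ := H D hDc (fun d => f d) (fun d => ‖t‖ * ‖(d : X) - x‖)
      (fun d => by positivity) fun a b => by
        rw [← f.map_sub, ← mul_add]
        refine (hf _).trans (mul_le_mul_of_nonneg_left ?_ (norm_nonneg t))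
        rw [norm_sub_rev (b : X) x]
        exact norm_sub_le_norm_sub_add_norm_sub _ _ _
    have hcont : Continuous f := AddMonoidHomClass.continuous_of_bound f.toFun ‖t‖ hf
    have hall : ∀ y : f.domain, ‖f y - e‖ ≤ ‖t‖ * ‖(y : X) - x‖ := fun y => by
      have hcl : IsClosed {y : f.domain | ‖f y - e‖ ≤ ‖t‖ * ‖(y : X) - x‖} :=
        isClosed_le (by fun_prop) (by fun_prop)
      refine closure_minimal (fun d hd => ?_) hcl (hD y)
      have := mem_iInter.1 he ⟨d, hd⟩
      rwa [mem_closedBall', dist_eq_norm] at this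
    have hg := hmax.2 (y := f.supSpanSingleton x e hx) (f.norm_supSpanSingleton_le hf hx hall)
      (f.left_le_sup _ _)
    exact hx (hg.1 (Submodule.mem_sup_right (Submodule.mem_span_singleton_self x)))
  let T : X →ₗ[ℝ] E := f.toFun.comp (LinearMap.id.codRestrict f.domain fun x => htop ▸ trivial)
  refine ⟨T.mkContinuous ‖t‖ fun x => hf _, T.mkContinuous_norm_le (norm_nonneg t) _, fun y => ?_⟩
  exact (hle.2 (x := y) (y := ⟨y, hle.1 y.2⟩) rfl).symm

theorem closedBall_inter_closedBall_nonempty_iff {E : Type} [NormedAddCommGroup E]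
    [NormedSpace ℝ E] {x y : E} {r s : ℝ} (hr : 0 ≤ r) (hs : 0 ≤ s) :
    (closedBall x r ∩ closedBall y s).Nonempty ↔ ‖x - y‖ ≤ r + s := by
  rw [← not_disjoint_iff_nonempty_inter, disjoint_closedBall_closedBall_iff hr hs, not_lt,
    dist_eq_norm]

theorem stmt7
    (E : Type) [NormedAddCommGroup E] [NormedSpace ℝ E] [CompleteSpace E]
    (ℵ : Cardinal) (hℵ : Cardinal.aleph0 < ℵ) :
    OneAlephInjective E ℵ ↔
      ∀ (ι : Type), #ι < ℵ → ∀ (x : ι → E) (r : ι → ℝ),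
        (∀ i j, (Metric.closedBall (x i) (r i) ∩ Metric.closedBall (x j) (r j)).Nonempty) →
        (⋂ i, Metric.closedBall (x i) (r i)).Nonempty := by
  constructor
  · intro hE ι hι x r h
    have hr : ∀ i, 0 ≤ r i := fun i => nonempty_closedBall.1 (h i i).left
    exact hE.nonempty_iInter_closedBall hℵ hι x r fun i j =>
      (closedBall_inter_closedBall_nonempty_iff (hr i) (hr j)).1 (h i j)
  · intro H
    exact oneAlephInjective_of_nonempty_iInter_closedBall hℵ fun ι hι x r hr h =>
      H ι hι x r fun i j => (closedBall_inter_closedBall_nonempty_iff (hr i) (hr j)).2 (h i j)
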